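/- arXiv:1405.0985 — 8 statements merged into one kernel-verified Lean document; each statement's English description precedes it below -/
import Mathlib

section
/- Let U be a unitary operator on a complex Hilbert space H, let V ⊆ H be a closed subspace with orthogonal projection P, and write P^⊥ = 1 − P. Then for every z ∈ ℂ with |z| < 1, the operator U − z·P^⊥ is invertible in B(H) and P ∘ (U − z·P^⊥)^{-1} ∘ U ∘ P = P; equivalently, P ∘ (1 − z·U*∘P^⊥)^{-1} ∘ P = P. -/
/-- For a unitary `U` on a complex Hilbert space `H` and the orthogonal
projection `P` onto a closed subspace (i.e. a self-adjoint idempotent), with `P⊥ = 1 - P`: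
for `|z| < 1` the operator `U - z • P⊥` is invertible and
`P ∘ (U - z•P⊥)⁻¹ ∘ U ∘ P = P`; equivalently `P ∘ (1 - z•U⋆∘P⊥)⁻¹ ∘ P = P`. -/
theorem statement1 {H : Type*} [NormedAddCommGroup H] [InnerProductSpace ℂ H]
    [CompleteSpace H] (U P : H →L[ℂ] H) (hU : U ∈ unitary (H →L[ℂ] H))
    (hPsa : IsSelfAdjoint P) (hPidem : P * P = P) (z : ℂ) (hz : ‖z‖ < 1) :
    IsUnit (U - z • ((1 : H →L[ℂ] H) - P)) ∧
    P * Ring.inverse (U - z • ((1 : H →L[ℂ] H) - P)) * U * P = P ∧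
    IsUnit ((1 : H →L[ℂ] H) - z • (star U * ((1 : H →L[ℂ] H) - P))) ∧
    P * Ring.inverse ((1 : H →L[ℂ] H) - z • (star U * ((1 : H →L[ℂ] H) - P))) * P = P := by
  have hQ : ‖(1 : H →L[ℂ] H) - P‖ ≤ 1 := by
    have h : IsStarProjection P := ⟨hPidem, hPsa⟩
    exact h.one_sub.norm_le
  have hUU : star U * U = 1 := Unitary.star_mul_self_of_mem hU
  have hUU2 : U * star U = 1 := Unitary.mul_star_self_of_mem hU
  have hn : ‖z • (star U * ((1 : H →L[ℂ] H) - P))‖ < 1 := by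
    rw [norm_smul, CStarRing.norm_mem_unitary_mul _ (Unitary.star_mem hU)]
    calc ‖z‖ * ‖(1 : H →L[ℂ] H) - P‖ ≤ ‖z‖ * 1 := by gcongr
      _ < 1 := by simpa using hz
  have h3 : IsUnit ((1 : H →L[ℂ] H) - z • (star U * ((1 : H →L[ℂ] H) - P))) :=
    isUnit_one_sub_of_norm_lt_one hn
  have hUunit : IsUnit U := ⟨⟨U, star U, hUU2, hUU⟩, rfl⟩
  have hfac : U - z • ((1 : H →L[ℂ] H) - P)
      = U * ((1 : H →L[ℂ] H) - z • (star U * ((1 : H →L[ℂ] H) - P))) := by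
    rw [mul_sub, mul_one, mul_smul_comm, ← mul_assoc, hUU2, one_mul]
  have h1 : IsUnit (U - z • ((1 : H →L[ℂ] H) - P)) := by
    rw [hfac]; exact hUunit.mul h3
  have hQP : ((1 : H →L[ℂ] H) - P) * P = 0 := by rw [sub_mul, one_mul, hPidem, sub_self]
  have e1 : (U - z • ((1 : H →L[ℂ] H) - P)) * P = U * P := by
    rw [sub_mul, smul_mul_assoc, hQP, smul_zero, sub_zero]
  have e3 : ((1 : H →L[ℂ] H) - z • (star U * ((1 : H →L[ℂ] H) - P))) * P = P := by
    rw [sub_mul, smul_mul_assoc, mul_assoc, hQP, mul_zero, smul_zero, sub_zero, one_mul]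
  refine ⟨h1, ?_, h3, ?_⟩
  · rw [mul_assoc, mul_assoc, ← e1, Ring.inverse_mul_cancel_left _ _ h1, hPidem]
  · conv_lhs => rw [mul_assoc]; enter [2, 2]; rw [← e3]
    rw [Ring.inverse_mul_cancel_left _ _ h3, hPidem]
end

section
/- Let U be a unitary operator on a complex Hilbert space H, let V ⊆ H be a closed subspace with orthogonal projection P, and write P^⊥ = 1 − P. For every integer n ≥ 1 define the first return amplitude a_{V,n} = P ∘ U ∘ (P^⊥ ∘ U)^{n−1} ∘ P ∈ B(H). Then for every z ∈ ℂ with |z| < 1 the operator U − z·P^⊥ is invertible in B(H), and the series Σ_{n≥1} z^{n−1} · (a_{V,n})* converges in operator norm to P ∘ (U − z·P^⊥)^{-1} ∘ P. -/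
/-- For a unitary `U`, a closed subspace with orthogonal projection `P`
(a self-adjoint idempotent) and `P⊥ = 1 - P`, the first return amplitudes are
`a_{V,n} = P ∘ U ∘ (P⊥ ∘ U)^(n-1) ∘ P` for `n ≥ 1`.  For `|z| < 1` the operator
`U - z • P⊥` is invertible and `Σ_{n≥1} z^(n-1) • (a_{V,n})⋆` converges in operator norm
to `P ∘ (U - z•P⊥)⁻¹ ∘ P`.  (Below the series is reindexed by `n ↦ n + 1`.) -/
theorem statement2 {H : Type*} [NormedAddCommGroup H] [InnerProductSpace ℂ H]
    [CompleteSpace H] (U P : H →L[ℂ] H) (hU : U ∈ unitary (H →L[ℂ] H))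
    (hPsa : IsSelfAdjoint P) (hPidem : P * P = P) (z : ℂ) (hz : ‖z‖ < 1) :
    IsUnit (U - z • ((1 : H →L[ℂ] H) - P)) ∧
    HasSum (fun n : ℕ => z ^ n • star (P * U * (((1 : H →L[ℂ] H) - P) * U) ^ n * P))
      (P * Ring.inverse (U - z • ((1 : H →L[ℂ] H) - P)) * P) := by
  obtain ⟨h1, h2⟩ := Unitary.mem_iff.mp hU
  set W := star U with hW
  set Q : H →L[ℂ] H := 1 - P with hQ
  have hQsa : star Q = Q := by
    rw [hQ, star_sub, star_one, hPsa.star_eq]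
  have hQid : Q * Q = Q := by
    rw [hQ, sub_mul, mul_sub P, hPidem]
    simp
  have hQn : ‖Q‖ ≤ 1 := by
    have h := CStarRing.norm_star_mul_self (x := Q)
    rw [hQsa, hQid] at h
    nlinarith [norm_nonneg Q]
  have hWn : ‖W‖ ≤ 1 := by
    have h := CStarRing.norm_star_mul_self (x := U)
    have h3 : ‖(1 : H →L[ℂ] H)‖ ≤ 1 := ContinuousLinearMap.norm_id_le
    rw [← hW, h1] at h
    rw [hW, norm_star]
    nlinarith [norm_nonneg U]
  have hA : ‖z • (W * Q)‖ < 1 := by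
    rw [norm_smul]
    have h3 : ‖W * Q‖ ≤ 1 := (norm_mul_le W Q).trans (mul_le_one₀ hWn (norm_nonneg _) hQn)
    nlinarith [norm_nonneg z, norm_nonneg (W * Q)]
  have hsum : Summable (fun n : ℕ => (z • (W * Q)) ^ n) :=
    summable_geometric_of_norm_lt_one hA
  have hl : (∑' n : ℕ, (z • (W * Q)) ^ n) * (1 - z • (W * Q)) = 1 :=
    geom_series_mul_neg _ hA
  have hr : (1 - z • (W * Q)) * (∑' n : ℕ, (z • (W * Q)) ^ n) = 1 :=
    mul_neg_geom_series _ hA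
  have hS := hsum.hasSum
  generalize (∑' n : ℕ, (z • (W * Q)) ^ n) = S at hl hr hS
  have hfac : U - z • Q = U * (1 - z • (W * Q)) := by
    rw [mul_sub, mul_one, mul_smul_comm, ← mul_assoc, h2, one_mul]
  let u : (H →L[ℂ] H)ˣ := ⟨U - z • Q, S * W,
    by rw [hfac, mul_assoc, ← mul_assoc _ S, hr, one_mul, h2],
    by rw [hfac, mul_assoc, ← mul_assoc W, h1, one_mul, hl]⟩
  have hinv : Ring.inverse (U - z • Q) = S * W := Ring.inverse_unit u
  refine ⟨u.isUnit, ?_⟩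
  rw [hinv]
  have h4 := ((hS.mul_right W).mul_left P).mul_right P
  have h7 : (fun n : ℕ => z ^ n • star (P * U * (Q * U) ^ n * P)) =
      fun n : ℕ => P * ((z • (W * Q)) ^ n * W) * P := by
    funext n
    rw [smul_pow, star_mul, star_mul, star_mul, star_pow, star_mul, hQsa, hPsa.star_eq, ← hW]
    simp only [smul_mul_assoc, mul_smul_comm, mul_assoc]
  rw [h7]
  exact h4
end

section
/- Let U be a unitary operator on a complex Hilbert space H, let V ⊆ H be a closed subspace with orthogonal projection P, and write P^⊥ = 1 − P. Then for every z ∈ ℂ with |z| < 1 the operators U − z·1 and U − z·P^⊥ are invertible in B(H), and (P − z·P∘(U − z·P^⊥)^{-1}∘P) ∘ (P∘(U − z·1)^{-1}∘(U + z·1)∘P + P) = 2·P. (Viewed as operators on V, this says that the U-Schur function f_V(z) = P(U − z·P^⊥)^{-1}P and the U-Carathéodory function F_V(z) = P(U + z)(U − z)^{-1}P satisfy (1_V − z·f_V(z))(F_V(z) + 1_V) = 2·1_V.) -/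
theorem aux_isUnit {H : Type*} [NormedAddCommGroup H] [InnerProductSpace ℂ H]
    [CompleteSpace H] (U Q : H →L[ℂ] H) (hU : U ∈ unitary (H →L[ℂ] H))
    (hQ : IsSelfAdjoint Q) (hQ2 : Q * Q = Q) (z : ℂ) (hz : ‖z‖ < 1) :
    IsUnit (U - z • Q) := by
  have hn : ‖Q‖ ≤ 1 := by
    have h : ‖Q‖ = ‖Q‖ * ‖Q‖ := by
      have h1 := CStarRing.norm_star_mul_self (x := Q)
      rwa [hQ.star_eq, hQ2] at h1
    nlinarith [norm_nonneg Q]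
  have h1 : star U * U = 1 := (Unitary.mem_iff.mp hU).1
  have h2 : U * star U = 1 := (Unitary.mem_iff.mp hU).2
  have hUu : IsUnit U := ⟨⟨U, star U, h2, h1⟩, rfl⟩
  have e : U - z • Q = U * (1 - star U * (z • Q)) := by
    rw [mul_sub, ← mul_assoc, h2, mul_one, one_mul]
  rw [e]
  refine hUu.mul (isUnit_one_sub_of_norm_lt_one ?_)
  have h3 : ‖star U * (z • Q)‖ = ‖z • Q‖ :=
    CStarRing.norm_mem_unitary_mul _ (Unitary.star_mem hU)
  rw [h3, norm_smul]
  nlinarith [norm_nonneg Q, norm_nonneg z]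


/-- For a unitary `U`, an orthogonal projection `P` (self-adjoint
idempotent) and `P⊥ = 1 - P`: for `|z| < 1` the operators `U - z•1` and `U - z•P⊥` are
invertible in `B(H)` and
`(P - z•P(U - z•P⊥)⁻¹P) ∘ (P(U - z•1)⁻¹(U + z•1)P + P) = 2•P`,
the operator form of `(1_V - z f_V(z))(F_V(z) + 1_V) = 2·1_V`. -/
theorem statement3 {H : Type*} [NormedAddCommGroup H] [InnerProductSpace ℂ H]
    [CompleteSpace H] (U P : H →L[ℂ] H) (hU : U ∈ unitary (H →L[ℂ] H))
    (hPsa : IsSelfAdjoint P) (hPidem : P * P = P) (z : ℂ) (hz : ‖z‖ < 1) :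
    IsUnit (U - z • (1 : H →L[ℂ] H)) ∧
    IsUnit (U - z • ((1 : H →L[ℂ] H) - P)) ∧
    (P - z • (P * Ring.inverse (U - z • ((1 : H →L[ℂ] H) - P)) * P)) *
      (P * Ring.inverse (U - z • (1 : H →L[ℂ] H)) * (U + z • (1 : H →L[ℂ] H)) * P + P) =
      (2 : ℂ) • P := by
  have hA : IsUnit (U - z • (1 : H →L[ℂ] H)) :=
    aux_isUnit U 1 hU (IsSelfAdjoint.one _) (one_mul 1) z hz
  have hB : IsUnit (U - z • ((1 : H →L[ℂ] H) - P)) :=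
    aux_isUnit U (1 - P) hU ((IsSelfAdjoint.one _).sub hPsa)
      (by rw [sub_mul, mul_sub, mul_sub, hPidem]; simp) z hz
  refine ⟨hA, hB, ?_⟩
  have hA1 := Ring.inverse_mul_cancel _ hA
  have hA2 := Ring.mul_inverse_cancel _ hA
  have hB1 := Ring.inverse_mul_cancel _ hB
  have eB : U - z • ((1 : H →L[ℂ] H) - P) = (U - z • (1 : H →L[ℂ] H)) + z • P := by
    rw [smul_sub]; abel
  have eBP : (U - z • ((1 : H →L[ℂ] H) - P)) * P = U * P := by
    rw [sub_mul, smul_mul_assoc, sub_mul, hPidem, one_mul, sub_self, smul_zero, sub_zero]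
  have eU : U + z • (1 : H →L[ℂ] H) = (2 : ℂ) • U - (U - z • (1 : H →L[ℂ] H)) := by
    rw [two_smul]; abel
  rw [eU]
  generalize Ring.inverse (U - z • ((1 : H →L[ℂ] H) - P)) = Y at *
  generalize Ring.inverse (U - z • (1 : H →L[ℂ] H)) = X at *
  have hF : P * X * ((2 : ℂ) • U - (U - z • (1 : H →L[ℂ] H))) * P + P
      = (2 : ℂ) • (P * (X * (U * P))) := by
    rw [mul_assoc P X, mul_sub X, hA1, mul_sub, sub_mul, mul_one, hPidem, sub_add_cancel]
    simp only [mul_smul_comm, smul_mul_assoc, mul_assoc]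
  have hY : Y * (U * P) = P := by
    rw [← eBP, ← mul_assoc, hB1, one_mul]
  have hYA : Y * (U - z • (1 : H →L[ℂ] H)) = 1 - z • (Y * P) := by
    rw [eB, mul_add, mul_smul_comm] at hB1
    exact eq_sub_of_add_eq hB1
  have hL : (P - z • (P * Y * P)) * P = P * (Y * (U - z • (1 : H →L[ℂ] H))) := by
    rw [hYA, sub_mul, mul_sub, hPidem, mul_one, smul_mul_assoc, mul_assoc (P * Y), hPidem,
      mul_smul_comm, mul_assoc]
  rw [hF, mul_smul_comm, ← mul_assoc _ P, hL]
  congr 1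
  calc P * (Y * (U - z • (1 : H →L[ℂ] H))) * (X * (U * P))
      = P * (Y * (((U - z • (1 : H →L[ℂ] H)) * X) * (U * P))) := by simp only [mul_assoc]
    _ = P := by rw [hA2, one_mul, hY, hPidem]
end

section
/- Let H be a complex Hilbert space with an orthogonal decomposition H = H_L ⊕ H_C ⊕ H_R and let U be a unitary operator on H. If (A, B) and (A', B') are two H_C-overlapping factorizations of U, then there exists a unitary operator W on H such that W x = x for every x ∈ H_L and every x ∈ H_R, W(H_C) ⊆ H_C, A' = A ∘ W and B' = W* ∘ B. Conversely, for every unitary W on H fixing H_L and H_R pointwise with W(H_C) ⊆ H_C, the pair (A ∘ W, W* ∘ B) is again an H_C-overlapping factorization of U. -/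
/-- An `H_C`-overlapping factorization of a unitary `U` relative to the orthogonal
decomposition `H = H_L ⊕ H_C ⊕ H_R` (encoded by the orthogonal projections
`PL, PC, PR`): unitaries `A, B` with `U = A ∘ B`, `A` fixing `H_R` pointwise and mapping
`H_LC = H_L ⊕ H_C` into itself, and `B` fixing `H_L` pointwise and mapping
`H_CR = H_C ⊕ H_R` into itself. -/
def IsOverlapFac {H : Type*} [NormedAddCommGroup H] [InnerProductSpace ℂ H]
    [CompleteSpace H] (PL PC PR U A B : H →L[ℂ] H) : Prop :=
  A ∈ unitary (H →L[ℂ] H) ∧ B ∈ unitary (H →L[ℂ] H) ∧ U = A * B ∧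
  A * PR = PR ∧ (PL + PC) * (A * (PL + PC)) = A * (PL + PC) ∧
  B * PL = PL ∧ (PC + PR) * (B * (PC + PR)) = B * (PC + PR)

/-- A unitary fixing the range of a self-adjoint `P` satisfies the adjoint identities. -/
theorem fix_aux {R : Type*} [Ring R] [StarRing R] {P V : R} (hP : IsSelfAdjoint P)
    (hV : V ∈ unitary R) (h : V * P = P) : star V * P = P ∧ P * V = P := by
  have h1 : star V * P = P := by
    conv_lhs => rw [← h]
    rw [← mul_assoc, Unitary.star_mul_self_of_mem hV, one_mul]
  refine ⟨h1, ?_⟩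
  have h2 := congrArg star h1
  rwa [star_mul, star_star, hP.star_eq] at h2

/-- A unitary fixing the range of a projection `P` preserves the complementary range. -/
theorem compl_aux {R : Type*} [Ring R] [StarRing R] {P V : R} (hP : IsSelfAdjoint P)
    (hPi : P * P = P) (hV : V ∈ unitary R) (h : V * P = P) :
    (1 - P) * (V * (1 - P)) = V * (1 - P) := by
  have h2 := (fix_aux hP hV h).2
  rw [sub_mul, one_mul, ← mul_assoc, h2, mul_sub P, hPi, mul_one, sub_self, sub_zero]

/-- Uniqueness of overlapping factorizations up to a unitary of `H_C`:
if `(A, B)` and `(A', B')` are `H_C`-overlapping factorizations of the same unitary `U`,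
then there is a unitary `W` fixing `H_L` and `H_R` pointwise with `W(H_C) ⊆ H_C`,
`A' = A ∘ W` and `B' = W⋆ ∘ B`; conversely any such `W` produces an `H_C`-overlapping
factorization `(A ∘ W, W⋆ ∘ B)` of `U`. -/
theorem statement7 {H : Type*} [NormedAddCommGroup H] [InnerProductSpace ℂ H]
    [CompleteSpace H] (PL PC PR : H →L[ℂ] H)
    (hPLsa : IsSelfAdjoint PL) (hPLi : PL * PL = PL)
    (hPCsa : IsSelfAdjoint PC) (hPCi : PC * PC = PC)
    (hPRsa : IsSelfAdjoint PR) (hPRi : PR * PR = PR)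
    (hsum : PL + PC + PR = 1)
    (hLC : PL * PC = 0) (hLR : PL * PR = 0) (hCR : PC * PR = 0)
    (U A B A' B' : H →L[ℂ] H) (hU : U ∈ unitary (H →L[ℂ] H))
    (hfac : IsOverlapFac PL PC PR U A B) (hfac' : IsOverlapFac PL PC PR U A' B') :
    (∃ W : H →L[ℂ] H, W ∈ unitary (H →L[ℂ] H) ∧
      W * PL = PL ∧ W * PR = PR ∧ PC * (W * PC) = W * PC ∧
      A' = A * W ∧ B' = star W * B) ∧
    (∀ W : H →L[ℂ] H, W ∈ unitary (H →L[ℂ] H) →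
      W * PL = PL → W * PR = PR → PC * (W * PC) = W * PC →
      IsOverlapFac PL PC PR U (A * W) (star W * B)) := by
  obtain ⟨hA, hB, hAB, hAR, -, hBL, -⟩ := hfac
  obtain ⟨hA', hB', hAB', hAR', -, hBL', -⟩ := hfac'
  have e1 : PL + PC = 1 - PR := by rw [← hsum]; abel
  have e2 : PC + PR = 1 - PL := by rw [← hsum]; abel
  have hRC : PR * PC = 0 := by
    have := congrArg star hCR
    rwa [star_mul, hPRsa.star_eq, hPCsa.star_eq, star_zero] at this
  refine ⟨⟨star A * A', ?_, ?_, ?_, ?_, ?_, ?_⟩, ?_⟩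
  · exact mul_mem (Unitary.star_mem hA) hA'
  · have hW : star A * A' = B * star B' := by
      calc star A * A' = star A * (A' * B') * star B' := by
            simp only [mul_assoc, Unitary.mul_star_self_of_mem hB', mul_one]
        _ = star A * (A * B) * star B' := by rw [← hAB', hAB]
        _ = B * star B' := by
            rw [← mul_assoc (star A), Unitary.star_mul_self_of_mem hA, one_mul]
    rw [hW, mul_assoc, (fix_aux hPLsa hB' hBL').1, hBL]
  · rw [mul_assoc, hAR', (fix_aux hPRsa hA hAR).1]
  · have hWu : star A * A' ∈ unitary (H →L[ℂ] H) := mul_mem (Unitary.star_mem hA) hA'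
    have hWR : star A * A' * PR = PR := by
      rw [mul_assoc, hAR', (fix_aux hPRsa hA hAR).1]
    have hW : star A * A' = B * star B' := by
      calc star A * A' = star A * (A' * B') * star B' := by
            simp only [mul_assoc, Unitary.mul_star_self_of_mem hB', mul_one]
        _ = star A * (A * B) * star B' := by rw [← hAB', hAB]
        _ = B * star B' := by
            rw [← mul_assoc (star A), Unitary.star_mul_self_of_mem hA, one_mul]
    have hWL : star A * A' * PL = PL := by
      rw [hW, mul_assoc, (fix_aux hPLsa hB' hBL').1, hBL]
    have f1 := (fix_aux hPRsa hWu hWR).2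
    have f2 := (fix_aux hPLsa hWu hWL).2
    have e3 : PC = 1 - PL - PR := by rw [← hsum]; abel
    generalize star A * A' = W at *
    calc PC * (W * PC) = (1 - PL - PR) * (W * PC) := by rw [← e3]
      _ = W * PC - (PL * W) * PC - (PR * W) * PC := by noncomm_ring
      _ = W * PC := by rw [f1, f2, hLC, hRC, sub_zero, sub_zero]
  · rw [← mul_assoc, Unitary.mul_star_self_of_mem hA, one_mul]
  · rw [star_mul, star_star, mul_assoc, ← hAB, hAB', ← mul_assoc,
      Unitary.star_mul_self_of_mem hA', one_mul]
  · intro W hW hWL hWR _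
    have u1 : A * W ∈ unitary (H →L[ℂ] H) := mul_mem hA hW
    have u2 : star W * B ∈ unitary (H →L[ℂ] H) := mul_mem (Unitary.star_mem hW) hB
    have g1 : A * W * PR = PR := by rw [mul_assoc, hWR, hAR]
    have g2 : star W * B * PL = PL := by rw [mul_assoc, hBL, (fix_aux hPLsa hW hWL).1]
    refine ⟨u1, u2, ?_, g1, ?_, g2, ?_⟩
    · rw [mul_assoc, ← mul_assoc W, Unitary.mul_star_self_of_mem hW, one_mul, hAB]
    · rw [e1]; exact compl_aux hPRsa hPRi u1 g1
    · rw [e2]; exact compl_aux hPLsa hPLi u2 g2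
end

section
/- Let H be a complex Hilbert space with an orthogonal decomposition H = H_L ⊕ H_C ⊕ H_R, and let U be a unitary operator on H with P_R ∘ U ∘ P_L = 0. Set K = P_LC ∘ U ∘ P_CR. Then K* ∘ K = P_CR − U* ∘ P_R ∘ U and K ∘ K* = P_LC − U ∘ P_L ∘ U*; in particular K* K and K K* are orthogonal projections, so K is a partial isometry. -/
theorem aux9 {A : Type*} [Ring A] (L R U V : A) (hL : L * L = L) (hR : R * R = R)
    (hVU : V * U = 1) (hUV : U * V = 1) (h1 : R * (U * L) = 0) (h2 : L * (V * R) = 0) :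
    ((V - V * R - L * V) * (U - R * U - U * L) = 1 - L - V * R * U) ∧
    IsIdempotentElem (1 - L - V * R * U) := by
  have hL' : ∀ x, L * (L * x) = L * x := fun x => by rw [← mul_assoc, hL]
  have hR' : ∀ x, R * (R * x) = R * x := fun x => by rw [← mul_assoc, hR]
  have hVU' : ∀ x, V * (U * x) = x := fun x => by rw [← mul_assoc, hVU, one_mul]
  have hUV' : ∀ x, U * (V * x) = x := fun x => by rw [← mul_assoc, hUV, one_mul]
  have h2' : ∀ x, L * (V * (R * x)) = 0 := fun x => by
    rw [← mul_assoc V, ← mul_assoc L, h2, zero_mul]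
  constructor
  · simp only [mul_sub, sub_mul, mul_assoc, hL, hR, hVU, h1, h2, hL', hR', hVU', h2', mul_one,
      one_mul, mul_zero]
    abel
  · unfold IsIdempotentElem
    simp only [mul_sub, sub_mul, mul_assoc, hL, hR, hVU, h1, h2, hL', hR', hVU', hUV', h2',
      mul_one, one_mul, mul_zero]
    abel

/-- With `H = H_L ⊕ H_C ⊕ H_R` (orthogonal projections `PL, PC, PR`) and
a unitary `U` satisfying `P_R U P_L = 0`, the operator `K = P_LC ∘ U ∘ P_CR` satisfies
`K⋆K = P_CR − U⋆ P_R U` and `KK⋆ = P_LC − U P_L U⋆`; in particular `K⋆K` and `KK⋆` are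
(orthogonal) projections, so `K` is a partial isometry. -/
theorem statement9 {H : Type*} [NormedAddCommGroup H] [InnerProductSpace ℂ H]
    [CompleteSpace H] (PL PC PR : H →L[ℂ] H)
    (hPLsa : IsSelfAdjoint PL) (hPLi : PL * PL = PL)
    (hPCsa : IsSelfAdjoint PC) (hPCi : PC * PC = PC)
    (hPRsa : IsSelfAdjoint PR) (hPRi : PR * PR = PR)
    (hsum : PL + PC + PR = 1)
    (hLC : PL * PC = 0) (hLR : PL * PR = 0) (hCR : PC * PR = 0)
    (U : H →L[ℂ] H) (hU : U ∈ unitary (H →L[ℂ] H))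
    (hzero : PR * U * PL = 0)
    (K : H →L[ℂ] H) (hK : K = (PL + PC) * U * (PC + PR)) :
    star K * K = (PC + PR) - star U * PR * U ∧
    K * star K = (PL + PC) - U * PL * star U ∧
    IsIdempotentElem (star K * K) ∧ IsIdempotentElem (K * star K) := by
  obtain ⟨hVU, hUV⟩ := Unitary.mem_iff.mp hU
  have e1 : PL + PC = 1 - PR := by rw [← hsum]; abel
  have e2 : PC + PR = 1 - PL := by rw [← hsum]; abel
  have h1 : PR * (U * PL) = 0 := by rw [← mul_assoc, hzero]
  have h2 : PL * (star U * PR) = 0 := by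
    have := congrArg star hzero
    simpa only [star_mul, hPLsa.star_eq, hPRsa.star_eq, star_zero] using this
  have k1 : K = U - PR * U - U * PL := by
    rw [hK, e1, e2]
    simp only [mul_sub, sub_mul, mul_one, one_mul, hzero]
    abel
  have k2 : star K = star U - star U * PR - PL * star U := by
    rw [k1]
    simp only [star_sub, star_mul, hPLsa.star_eq, hPRsa.star_eq]
  obtain ⟨a1, a2⟩ := aux9 PL PR U (star U) hPLi hPRi hVU hUV h1 h2
  obtain ⟨b1, b2⟩ := aux9 PR PL (star U) U hPRi hPLi hUV hVU h2 h1
  have c1 : star K * K = 1 - PL - star U * PR * U := by rw [k2, k1, a1]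
  have c2 : K * star K = 1 - PR - U * PL * star U := by
    rw [k2, k1, ← b1, sub_right_comm U, sub_right_comm (star U)]
  rw [c1, c2, e1, e2]
  exact ⟨rfl, rfl, a2, b2⟩
end

section
/- Let T_L, T_R, T be bounded linear operators on a complex Hilbert space H with ‖T_L‖ ≤ 1, ‖T_R‖ ≤ 1, ‖T‖ ≤ 1, and satisfying T_L∘T_R = T_R∘T_L = T∘T_L = T_R∘T = T∘T = 0. Then for every z ∈ ℂ with |z| < 1, the operator 1 − z·(T_L + T_R + T) is invertible in B(H), and its inverse equals (1 − z·T_L)^{-1} ∘ (1 + z·T) ∘ (1 − z·T_R)^{-1}. -/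
/-- If `T_L, T_R, T` are contractions on a complex Hilbert space with
`T_L T_R = T_R T_L = T T_L = T_R T = T T = 0`, then for `|z| < 1` the operator
`1 - z•(T_L + T_R + T)` is invertible in `B(H)` with inverse
`(1 - z•T_L)⁻¹ (1 + z•T) (1 - z•T_R)⁻¹`. -/
theorem statement10 {H : Type*} [NormedAddCommGroup H] [InnerProductSpace ℂ H]
    [CompleteSpace H] (TL TR T : H →L[ℂ] H)
    (hTL : ‖TL‖ ≤ 1) (hTR : ‖TR‖ ≤ 1) (hT : ‖T‖ ≤ 1)
    (h1 : TL * TR = 0) (h2 : TR * TL = 0) (h3 : T * TL = 0) (h4 : TR * T = 0)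
    (h5 : T * T = 0) (z : ℂ) (hz : ‖z‖ < 1) :
    IsUnit ((1 : H →L[ℂ] H) - z • (TL + TR + T)) ∧
    IsUnit ((1 : H →L[ℂ] H) - z • TL) ∧
    IsUnit ((1 : H →L[ℂ] H) - z • TR) ∧
    Ring.inverse ((1 : H →L[ℂ] H) - z • (TL + TR + T)) =
      Ring.inverse ((1 : H →L[ℂ] H) - z • TL) * ((1 : H →L[ℂ] H) + z • T) *
        Ring.inverse ((1 : H →L[ℂ] H) - z • TR) := by
  have key : ∀ S : H →L[ℂ] H, ‖S‖ ≤ 1 → IsUnit ((1 : H →L[ℂ] H) - z • S) := by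
    intro S hS
    apply isUnit_one_sub_of_norm_lt_one
    rw [norm_smul]
    nlinarith [norm_nonneg z, norm_nonneg S]
  have hL := key TL hTL
  have hR := key TR hTR
  have hM1 : ((1 : H →L[ℂ] H) - z • T) * (1 + z • T) = 1 := by
    simp [mul_add, sub_mul, h5]
  have hM2 : ((1 : H →L[ℂ] H) + z • T) * (1 - z • T) = 1 := by
    simp [mul_sub, add_mul, h5]
  have hfac : (1 : H →L[ℂ] H) - z • (TL + TR + T) =
      (1 - z • TR) * (1 - z • T) * (1 - z • TL) := by
    simp only [mul_sub, sub_mul, mul_one, one_mul, smul_mul_assoc, mul_smul_comm, h2, h3, h4,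
      smul_zero, zero_mul, smul_add, smul_sub, sub_zero, mul_zero, mul_assoc]
    abel
  have hM : IsUnit ((1 : H →L[ℂ] H) - z • T) := ⟨⟨_, _, hM1, hM2⟩, rfl⟩
  refine ⟨hfac ▸ (hR.mul hM).mul hL, hL, hR, ?_⟩
  rw [hfac]
  obtain ⟨a, ha⟩ := hL
  obtain ⟨b, hb⟩ := hR
  let m : (H →L[ℂ] H)ˣ := ⟨_, _, hM1, hM2⟩
  have hm : (1 : H →L[ℂ] H) - z • T = (m : H →L[ℂ] H) := rfl
  have hm' : (1 : H →L[ℂ] H) + z • T = ((m⁻¹ : (H →L[ℂ] H)ˣ) : H →L[ℂ] H) := rfl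
  rw [← ha, ← hb, hm, hm', ← Units.val_mul, ← Units.val_mul, Ring.inverse_unit,
    Ring.inverse_unit, Ring.inverse_unit, mul_inv_rev, mul_inv_rev, Units.val_mul, Units.val_mul,
    mul_assoc]
end

section
/- Let U be a unitary operator on a complex Hilbert space H, P the orthogonal projection onto a closed subspace V ⊆ H, and P^⊥ = 1 − P. Then for every z ∈ ℂ with |z| < 1, the operators 1 − z·P^⊥∘U and 1 − z·P^⊥∘U∘P^⊥ are invertible in B(H), and z·P∘U∘(1 − z·P^⊥∘U)^{-1}∘P = z·P∘U∘P + z²·P∘U∘P^⊥∘(1 − z·P^⊥∘U∘P^⊥)^{-1}∘P^⊥∘U∘P; moreover both sides equal the norm-convergent series Σ_{n≥1} z^n · P∘U∘(P^⊥∘U)^{n−1}∘P. -/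
/-- For a unitary `U`, an orthogonal projection `P` (self-adjoint
idempotent) and `P⊥ = 1 - P`: for `|z| < 1` the operators `1 - z•P⊥U` and `1 - z•P⊥UP⊥`
are invertible, and the first return generating function satisfies
`z P U (1 − z P⊥U)⁻¹ P = z P U P + z² P U P⊥ (1 − z P⊥UP⊥)⁻¹ P⊥ U P`;
both sides equal the norm-convergent series `Σ_{n≥1} zⁿ P U (P⊥U)^{n−1} P`. -/
theorem statement13 {H : Type*} [NormedAddCommGroup H] [InnerProductSpace ℂ H]
    [CompleteSpace H] (U P : H →L[ℂ] H) (hU : U ∈ unitary (H →L[ℂ] H))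
    (hPsa : IsSelfAdjoint P) (hPidem : P * P = P) (z : ℂ) (hz : ‖z‖ < 1) :
    IsUnit ((1 : H →L[ℂ] H) - z • (((1 : H →L[ℂ] H) - P) * U)) ∧
    IsUnit ((1 : H →L[ℂ] H) - z • (((1 : H →L[ℂ] H) - P) * U * ((1 : H →L[ℂ] H) - P))) ∧
    z • (P * U *
        Ring.inverse ((1 : H →L[ℂ] H) - z • (((1 : H →L[ℂ] H) - P) * U)) * P) =
      z • (P * U * P) +
      z ^ 2 • (P * U * ((1 : H →L[ℂ] H) - P) *
        Ring.inverse
          ((1 : H →L[ℂ] H) - z • (((1 : H →L[ℂ] H) - P) * U * ((1 : H →L[ℂ] H) - P))) *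
        ((1 : H →L[ℂ] H) - P) * U * P) ∧
    HasSum (fun n : ℕ => z ^ (n + 1) • (P * U * (((1 : H →L[ℂ] H) - P) * U) ^ n * P))
      (z • (P * U *
        Ring.inverse ((1 : H →L[ℂ] H) - z • (((1 : H →L[ℂ] H) - P) * U)) * P)) := by
  have hPs : IsStarProjection P := ⟨hPidem, hPsa⟩
  have hQs := hPs.one_sub
  have hQn : ‖(1 : H →L[ℂ] H) - P‖ ≤ 1 := hQs.norm_le
  have hQQ : ((1 : H →L[ℂ] H) - P) * (1 - P) = 1 - P := hQs.isIdempotentElem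
  generalize (1 : H →L[ℂ] H) - P = Q at *
  have hUn : ‖U‖ ≤ 1 := by
    have h1 : ‖star U * U‖ = ‖U‖ * ‖U‖ := CStarRing.norm_star_mul_self
    rw [(Unitary.mem_iff.mp hU).1] at h1
    have h2 : ‖(1 : H →L[ℂ] H)‖ ≤ 1 := ContinuousLinearMap.norm_id_le
    nlinarith [norm_nonneg U]
  have hA1 : ‖Q * U‖ ≤ 1 :=
    (norm_mul_le _ _).trans (mul_le_one₀ hQn (norm_nonneg _) hUn)
  have hB1 : ‖Q * U * Q‖ ≤ 1 :=
    (norm_mul_le _ _).trans (mul_le_one₀ hA1 (norm_nonneg _) hQn)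
  have hA : ‖z • (Q * U)‖ < 1 := by
    rw [norm_smul]; nlinarith [norm_nonneg z]
  have hB : ‖z • (Q * U * Q)‖ < 1 := by
    rw [norm_smul]; nlinarith [norm_nonneg z]
  have uA := isUnit_one_sub_of_norm_lt_one hA
  have uB := isUnit_one_sub_of_norm_lt_one hB
  refine ⟨uA, uB, ?_, ?_⟩
  · have hRb := Ring.mul_inverse_cancel _ uB
    have hRa := Ring.inverse_mul_cancel _ uA
    generalize Ring.inverse (1 - z • (Q * U * Q)) = R at *
    generalize Ring.inverse (1 - z • (Q * U)) = S at *
    have key : (1 - z • (Q * U)) * (1 + z • (Q * R * Q * U)) = 1 := by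
      have h3 : Q * R - z • (Q * U * Q * R) = Q := by
        have h4 := congrArg (fun X => Q * X) hRb
        simp only [sub_mul, mul_sub, one_mul, mul_one, smul_mul_assoc, mul_smul_comm] at h4
        have h5 : Q * (Q * U * Q * R) = Q * U * Q * R := by
          simp only [← mul_assoc, hQQ]
        rwa [h5] at h4
      have h6 : (1 - z • (Q * U)) * (1 + z • (Q * R * Q * U))
          = 1 - z • (Q * U) + z • ((Q * R - z • (Q * U * Q * R)) * (Q * U)) := by
        simp only [sub_mul, mul_add, one_mul, mul_one, smul_mul_assoc, mul_smul_comm, smul_sub,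
          mul_assoc]
      rw [h6, h3, ← mul_assoc, hQQ]
      abel
    have hS : S = 1 + z • (Q * R * Q * U) := by
      calc S = S * ((1 - z • (Q * U)) * (1 + z • (Q * R * Q * U))) := by rw [key, mul_one]
        _ = _ := by rw [← mul_assoc, hRa, one_mul]
    rw [hS]
    simp only [mul_add, add_mul, mul_one, smul_add, smul_mul_assoc, mul_smul_comm, smul_smul,
      pow_two, mul_assoc]
  · have h := hasSum_geom_series_inverse _ hA
    have h' := ((h.mul_left (P * U)).mul_right P).const_smul z
    have hf : (fun n : ℕ => z ^ (n + 1) • (P * U * (Q * U) ^ n * P))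
        = fun n : ℕ => z • (P * U * (z • (Q * U)) ^ n * P) := by
      funext n
      rw [smul_pow, mul_smul_comm, smul_mul_assoc, smul_smul, pow_succ']
    rw [hf]
    exact h'
end

section
/- Fix integers d ≥ 1 and N ≥ 1 and d×d complex matrices α_0, …, α_{N−1} with ‖α_j‖ ≤ 1, and form the finite block CMV matrices C_N(α_0,…,α_{N−1}) = L_N·M_N and Ĉ_N(α_0,…,α_{N−1}) = M_N·L_N. Then for every integer j with 0 < j < N the following overlapping factorizations hold, where 1_m denotes the m×m identity matrix and X ⊕ Y the block-diagonal matrix with blocks X and Y: if j is even, C_N(α_0,…,α_{N−1}) = (1_{jd} ⊕ C_{N−j}(α_j,…,α_{N−1})) · (C_j(α_0,…,α_{j−1}) ⊕ 1_{(N−j)d}) and Ĉ_N(α_0,…,α_{N−1}) = (Ĉ_j(α_0,…,α_{j−1}) ⊕ 1_{(N−j)d}) · (1_{jd} ⊕ Ĉ_{N−j}(α_j,…,α_{N−1})); if j is odd, C_N(α_0,…,α_{N−1}) = (C_j(α_0,…,α_{j−1}) ⊕ 1_{(N−j)d}) · (1_{jd} ⊕ Ĉ_{N−j}(α_j,…,α_{N−1}))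 and Ĉ_N(α_0,…,α_{N−1}) = (1_{jd} ⊕ C_{N−j}(α_j,…,α_{N−1})) · (Ĉ_j(α_0,…,α_{j−1}) ⊕ 1_{(N−j)d}). -/
open Matrix
open scoped ComplexOrder

/-- The elementary CMV block `Θ_j^{(N)} = 1_{jd} ⊕ Θ(α_j) ⊕ 1_{(N−j−1)d}` of size
`(N+1)d`, indexed by `Fin (N+1) × Fin d` (block index first), where
`Θ(α) = [[αᴴ, ρ^L], [ρ^R, −α]]`. -/
noncomputable def thetaBlock (d N j : ℕ) (A ρl ρr : Matrix (Fin d) (Fin d) ℂ) :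
    Matrix (Fin (N + 1) × Fin d) (Fin (N + 1) × Fin d) ℂ := fun p q =>
  if p.1.val = j ∧ q.1.val = j then Aᴴ p.2 q.2
  else if p.1.val = j ∧ q.1.val = j + 1 then ρl p.2 q.2
  else if p.1.val = j + 1 ∧ q.1.val = j then ρr p.2 q.2
  else if p.1.val = j + 1 ∧ q.1.val = j + 1 then (-A) p.2 q.2
  else if p = q then 1 else 0

/-- `L_N`: the product of the blocks `Θ_j^{(N)}` over even `j < N` (the factors pairwise
commute, so the ascending order chosen here is irrelevant). -/
noncomputable def cmvLfactor (d N : ℕ) (α ρl ρr : ℕ → Matrix (Fin d) (Fin d) ℂ) :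
    Matrix (Fin (N + 1) × Fin d) (Fin (N + 1) × Fin d) ℂ :=
  ((List.range N).map fun j =>
    if Even j then thetaBlock d N j (α j) (ρl j) (ρr j) else 1).prod

/-- `M_N`: the product of the blocks `Θ_j^{(N)}` over odd `j < N`. -/
noncomputable def cmvMfactor (d N : ℕ) (α ρl ρr : ℕ → Matrix (Fin d) (Fin d) ℂ) :
    Matrix (Fin (N + 1) × Fin d) (Fin (N + 1) × Fin d) ℂ :=
  ((List.range N).map fun j =>
    if Odd j then thetaBlock d N j (α j) (ρl j) (ρr j) else 1).prod

/-- The finite block CMV matrix `C_N(α_0, …, α_{N−1}) = L_N · M_N`. -/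
noncomputable def cmvC (d N : ℕ) (α ρl ρr : ℕ → Matrix (Fin d) (Fin d) ℂ) :
    Matrix (Fin (N + 1) × Fin d) (Fin (N + 1) × Fin d) ℂ :=
  cmvLfactor d N α ρl ρr * cmvMfactor d N α ρl ρr

/-- The alternate finite block CMV matrix `Ĉ_N(α_0, …, α_{N−1}) = M_N · L_N`. -/
noncomputable def cmvChat (d N : ℕ) (α ρl ρr : ℕ → Matrix (Fin d) (Fin d) ℂ) :
    Matrix (Fin (N + 1) × Fin d) (Fin (N + 1) × Fin d) ℂ :=
  cmvMfactor d N α ρl ρr * cmvLfactor d N α ρl ρr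

/-- Embed a matrix of `m+1` blocks into one of `N+1` blocks at block offset `o`, acting
as the identity outside: this realizes the block-diagonal direct sums `1_{od} ⊕ M ⊕ 1_…`. -/
noncomputable def embedAt (d N o m : ℕ)
    (M : Matrix (Fin (m + 1) × Fin d) (Fin (m + 1) × Fin d) ℂ) :
    Matrix (Fin (N + 1) × Fin d) (Fin (N + 1) × Fin d) ℂ := fun p q =>
  if h : o ≤ p.1.val ∧ p.1.val ≤ o + m ∧ o ≤ q.1.val ∧ q.1.val ≤ o + m then
    M (⟨p.1.val - o, by omega⟩, p.2) (⟨q.1.val - o, by omega⟩, q.2)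
  else if p = q then 1 else 0

theorem thetaBlock_sub_one_apply (d N j : ℕ) (A ρl ρr : Matrix (Fin d) (Fin d) ℂ)
    (p q : Fin (N + 1) × Fin d)
    (h : ¬ ((p.1.val = j ∨ p.1.val = j + 1) ∧ (q.1.val = j ∨ q.1.val = j + 1))) :
    (thetaBlock d N j A ρl ρr - 1) p q = 0 := by
  rw [Matrix.sub_apply, Matrix.one_apply]
  unfold thetaBlock
  rw [if_neg (by omega), if_neg (by omega), if_neg (by omega), if_neg (by omega), sub_self]

theorem thetaBlock_mul_zero (d N i j : ℕ) (A ρl ρr A' ρl' ρr' : Matrix (Fin d) (Fin d) ℂ)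
    (h : i + 2 ≤ j ∨ j + 2 ≤ i) :
    (thetaBlock d N i A ρl ρr - 1) * (thetaBlock d N j A' ρl' ρr' - 1) = 0 := by
  ext p q
  rw [Matrix.mul_apply, Matrix.zero_apply]
  refine Finset.sum_eq_zero fun r _ => ?_
  by_cases hr : r.1.val = i ∨ r.1.val = i + 1
  · rw [thetaBlock_sub_one_apply d N j A' ρl' ρr' r q (by omega), mul_zero]
  · rw [thetaBlock_sub_one_apply d N i A ρl ρr p r (by omega), zero_mul]

theorem thetaBlock_commute (d N i j : ℕ) (A ρl ρr A' ρl' ρr' : Matrix (Fin d) (Fin d) ℂ)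
    (h : i + 2 ≤ j) :
    Commute (thetaBlock d N i A ρl ρr) (thetaBlock d N j A' ρl' ρr') := by
  have h1 := thetaBlock_mul_zero d N i j A ρl ρr A' ρl' ρr' (Or.inl h)
  have h2 := thetaBlock_mul_zero d N j i A' ρl' ρr' A ρl ρr (Or.inr h)
  have h3 : Commute (thetaBlock d N i A ρl ρr - 1) (thetaBlock d N j A' ρl' ρr' - 1) :=
    h1.trans h2.symm
  simpa using (h3.add_right (Commute.one_right _)).add_left (Commute.one_left _)

theorem embedAt_one (d N o m : ℕ) : embedAt d N o m 1 = 1 := by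
  ext p q
  unfold embedAt
  rw [Matrix.one_apply]
  split_ifs with h h' h'
  · subst h'; simp
  · rw [Matrix.one_apply, if_neg]
    intro he
    apply h'
    simp only [Prod.mk.injEq, Fin.mk.injEq] at he
    exact Prod.ext (Fin.ext (by omega)) he.2
  · rfl
  · rfl

theorem embedAt_theta (d N o m k : ℕ) (hk : k < m) (A ρl ρr : Matrix (Fin d) (Fin d) ℂ) :
    embedAt d N o m (thetaBlock d m k A ρl ρr) = thetaBlock d N (o + k) A ρl ρr := by
  ext p q
  obtain ⟨⟨p, hp⟩, s⟩ := p
  obtain ⟨⟨q, hq⟩, t⟩ := q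
  unfold embedAt
  split_ifs with h h'
  · simp only at h
    unfold thetaBlock
    have e1 : ∀ x, (p - o = k + x ↔ p = o + k + x) := by omega
    have e2 : ∀ x, (q - o = k + x ↔ q = o + k + x) := by omega
    have e3 : p - o = k ↔ p = o + k := by omega
    have e4 : q - o = k ↔ q = o + k := by omega
    have e5 : p - o = q - o ↔ p = q := by omega
    simp only [e1, e2, e3, e4, e5, Prod.mk.injEq, Fin.mk.injEq]
  · simp only at h
    unfold thetaBlock
    simp only
    rw [if_neg (by omega), if_neg (by omega), if_neg (by omega), if_neg (by omega), if_pos h']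
  · simp only at h
    unfold thetaBlock
    simp only
    rw [if_neg (by omega), if_neg (by omega), if_neg (by omega), if_neg (by omega), if_neg h']

theorem embedAt_mul (d N o m : ℕ) (hm : o + m ≤ N)
    (A B : Matrix (Fin (m + 1) × Fin d) (Fin (m + 1) × Fin d) ℂ) :
    embedAt d N o m (A * B) = embedAt d N o m A * embedAt d N o m B := by
  ext p q
  rw [Matrix.mul_apply]
  by_cases hp : o ≤ p.1.val ∧ p.1.val ≤ o + m
  · by_cases hq : o ≤ q.1.val ∧ q.1.val ≤ o + m
    · have hL : embedAt d N o m (A * B) p q =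
          (A * B) (⟨p.1.val - o, by omega⟩, p.2) (⟨q.1.val - o, by omega⟩, q.2) := by
        unfold embedAt
        rw [dif_pos ⟨hp.1, hp.2, hq.1, hq.2⟩]
      rw [hL, Matrix.mul_apply]
      refine Fintype.sum_of_injective
        (fun r : Fin (m + 1) × Fin d => ((⟨o + r.1.val, by omega⟩, r.2) : Fin (N + 1) × Fin d))
        ?_ _ _ ?_ ?_
      · intro r s hrs
        simp only [Prod.mk.injEq, Fin.mk.injEq] at hrs
        exact Prod.ext (Fin.ext (by omega)) hrs.2
      · intro r hr
        have hr' : ¬ (o ≤ r.1.val ∧ r.1.val ≤ o + m) := by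
          intro h
          apply hr
          refine ⟨(⟨r.1.val - o, by omega⟩, r.2), ?_⟩
          exact Prod.ext (Fin.ext (by simp only; omega)) rfl
        have : embedAt d N o m A p r = 0 := by
          unfold embedAt
          rw [dif_neg (by omega), if_neg]
          rintro rfl
          exact hr' hp
        rw [this, zero_mul]
      · intro r
        have := r.1.isLt
        unfold embedAt
        simp only
        rw [dif_pos (by omega), dif_pos (by omega)]
        simp
    · have hB : ∀ r, embedAt d N o m B r q = (1 : Matrix _ _ ℂ) r q := by
        intro r
        unfold embedAt
        rw [dif_neg (by omega), Matrix.one_apply]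
      simp only [hB]
      rw [← Matrix.mul_apply, mul_one]
      unfold embedAt
      rw [dif_neg (by omega), dif_neg (by omega)]
  · have hA : ∀ r, embedAt d N o m A p r = (1 : Matrix _ _ ℂ) p r := by
      intro r
      unfold embedAt
      rw [dif_neg (by omega), Matrix.one_apply]
    simp only [hA]
    rw [← Matrix.mul_apply, one_mul]
    unfold embedAt
    rw [dif_neg (by omega), dif_neg (by omega)]

open Classical in
/-- product of the `Θ_{o+k}` with `k < n` and `P (o+k)` -/
noncomputable def segProd (d N : ℕ) (α ρl ρr : ℕ → Matrix (Fin d) (Fin d) ℂ)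
    (P : ℕ → Prop) (o n : ℕ) :
    Matrix (Fin (N + 1) × Fin d) (Fin (N + 1) × Fin d) ℂ :=
  ((List.range n).map fun k => if P (o + k) then
    thetaBlock d N (o + k) (α (o + k)) (ρl (o + k)) (ρr (o + k)) else 1).prod

theorem segProd_commute (d N : ℕ) (α ρl ρr : ℕ → Matrix (Fin d) (Fin d) ℂ)
    (P Q : ℕ → Prop) (j n : ℕ)
    (h : ∀ i k, i < j → P i → Q (j + k) → i + 2 ≤ j + k) :
    Commute (segProd d N α ρl ρr P 0 j) (segProd d N α ρl ρr Q j n) := by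
  unfold segProd
  refine Commute.list_prod_left _ _ fun x hx => Commute.list_prod_right _ _ fun y hy => ?_
  simp only [List.mem_map, List.mem_range] at hx hy
  obtain ⟨i, hi, rfl⟩ := hx
  obtain ⟨k, hk, rfl⟩ := hy
  split_ifs with h1 h2 h2
  · exact thetaBlock_commute _ _ _ _ _ _ _ _ _ _ (h _ _ (by omega) h1 h2)
  · exact Commute.one_right _
  · exact Commute.one_left _
  · exact Commute.one_left _

theorem segProd_split (d N : ℕ) (α ρl ρr : ℕ → Matrix (Fin d) (Fin d) ℂ)
    (P : ℕ → Prop) (j : ℕ) (h : j ≤ N) :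
    segProd d N α ρl ρr P 0 N =
      segProd d N α ρl ρr P 0 j * segProd d N α ρl ρr P j (N - j) := by
  unfold segProd
  conv_lhs => rw [show List.range N = List.range (j + (N - j)) by congr 1; omega]
  rw [List.range_add, List.map_append, List.prod_append, List.map_map]
  simp only [Function.comp_def, zero_add]
  congr! 6
  rw [zero_add]

theorem embedAt_seg (d N : ℕ) (α ρl ρr : ℕ → Matrix (Fin d) (Fin d) ℂ)
    (P Q : ℕ → Prop) (o m : ℕ) (hm : o + m ≤ N) (hPQ : ∀ k, P k ↔ Q (o + k)) :
    embedAt d N o m (segProd d m (fun k => α (o + k)) (fun k => ρl (o + k))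
      (fun k => ρr (o + k)) P 0 m) = segProd d N α ρl ρr Q o m := by
  unfold segProd
  have key : ∀ l : List ℕ, (∀ k ∈ l, k < m) → ∀ F : ℕ → Matrix _ _ ℂ, ∀ G : ℕ → Matrix _ _ ℂ,
      (∀ k, k < m → embedAt d N o m (F k) = G k) →
      embedAt d N o m (l.map F).prod = (l.map G).prod := by
    intro l
    induction l with
    | nil => intro _ F G _; simpa using embedAt_one d N o m
    | cons a l ih =>
      intro hl F G hFG
      rw [List.map_cons, List.map_cons, List.prod_cons, List.prod_cons, embedAt_mul _ _ _ _ hm,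
        hFG a (hl a (by simp)), ih (fun k hk => hl k (by simp [hk])) F G hFG]
  refine key _ (fun k hk => List.mem_range.1 hk) _ _ fun k hk => ?_
  have e : P (0 + k) ↔ Q (o + k) := by rw [zero_add, hPQ]
  by_cases hQ : Q (o + k)
  · rw [if_pos hQ, if_pos (e.2 hQ)]
    simp only [zero_add]
    exact embedAt_theta _ _ _ _ _ hk _ _ _
  · rw [if_neg hQ, if_neg (fun h => hQ (e.1 h))]
    exact embedAt_one _ _ _ _

theorem cmvL_eq (d N : ℕ) (α ρl ρr : ℕ → Matrix (Fin d) (Fin d) ℂ) :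
    cmvLfactor d N α ρl ρr = segProd d N α ρl ρr Even 0 N := by
  unfold cmvLfactor segProd
  simp only [zero_add]

theorem cmvM_eq (d N : ℕ) (α ρl ρr : ℕ → Matrix (Fin d) (Fin d) ℂ) :
    cmvMfactor d N α ρl ρr = segProd d N α ρl ρr Odd 0 N := by
  unfold cmvMfactor segProd
  simp only [zero_add]

theorem embedAt_seg_zero (d N : ℕ) (α ρl ρr : ℕ → Matrix (Fin d) (Fin d) ℂ)
    (P : ℕ → Prop) (m : ℕ) (hm : m ≤ N) :
    embedAt d N 0 m (segProd d m α ρl ρr P 0 m) = segProd d N α ρl ρr P 0 m := by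
  have := embedAt_seg d N α ρl ρr P P 0 m (by omega) (by simp)
  simpa using this

/-- (Overlapping factorizations of finite block CMV matrices.)
For `d ≥ 1`, `N ≥ 1`, `d×d` contractions `α_0, …, α_{N−1}` (encoded by the existence of
the positive semidefinite square roots `ρ^L_j, ρ^R_j` of `1 − α_jᴴ α_j` and
`1 − α_j α_jᴴ`), and every `0 < j < N`:
if `j` is even, `C_N = (1_{jd} ⊕ C_{N−j}(α_j, …)) · (C_j(α_0, …) ⊕ 1_{(N−j)d})` and
`Ĉ_N = (Ĉ_j(α_0, …) ⊕ 1_{(N−j)d}) · (1_{jd} ⊕ Ĉ_{N−j}(α_j, …))`;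
if `j` is odd, `C_N = (C_j(α_0, …) ⊕ 1_{(N−j)d}) · (1_{jd} ⊕ Ĉ_{N−j}(α_j, …))` and
`Ĉ_N = (1_{jd} ⊕ C_{N−j}(α_j, …)) · (Ĉ_j(α_0, …) ⊕ 1_{(N−j)d})`. -/
theorem statement16 (d N : ℕ) (hd : 1 ≤ d) (hN : 1 ≤ N)
    (α ρl ρr : ℕ → Matrix (Fin d) (Fin d) ℂ)
    (hρl : ∀ j, (ρl j).PosSemidef ∧
      ρl j * ρl j = (1 : Matrix (Fin d) (Fin d) ℂ) - (α j)ᴴ * α j)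
    (hρr : ∀ j, (ρr j).PosSemidef ∧
      ρr j * ρr j = (1 : Matrix (Fin d) (Fin d) ℂ) - α j * (α j)ᴴ)
    (j : ℕ) (hj0 : 0 < j) (hjN : j < N) :
    (Even j →
      cmvC d N α ρl ρr =
        embedAt d N j (N - j)
            (cmvC d (N - j) (fun k => α (j + k)) (fun k => ρl (j + k))
              (fun k => ρr (j + k))) *
          embedAt d N 0 j (cmvC d j α ρl ρr) ∧
      cmvChat d N α ρl ρr =
        embedAt d N 0 j (cmvChat d j α ρl ρr) *
          embedAt d N j (N - j)
            (cmvChat d (N - j) (fun k => α (j + k)) (fun k => ρl (j + k))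
              (fun k => ρr (j + k)))) ∧
    (Odd j →
      cmvC d N α ρl ρr =
        embedAt d N 0 j (cmvC d j α ρl ρr) *
          embedAt d N j (N - j)
            (cmvChat d (N - j) (fun k => α (j + k)) (fun k => ρl (j + k))
              (fun k => ρr (j + k))) ∧
      cmvChat d N α ρl ρr =
        embedAt d N j (N - j)
            (cmvC d (N - j) (fun k => α (j + k)) (fun k => ρl (j + k))
              (fun k => ρr (j + k))) *
          embedAt d N 0 j (cmvChat d j α ρl ρr)) := by
  have hm : j + (N - j) ≤ N := by omega
  have hj : 0 + j ≤ N := by omega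
  unfold cmvC cmvChat
  simp only [cmvL_eq, cmvM_eq]
  rw [embedAt_mul _ _ _ _ hm, embedAt_mul _ _ _ _ hm, embedAt_mul _ _ _ _ hj,
    embedAt_mul _ _ _ _ hj, embedAt_seg_zero _ _ _ _ _ _ _ hjN.le,
    embedAt_seg_zero _ _ _ _ _ _ _ hjN.le,
    segProd_split d N α ρl ρr Even j hjN.le, segProd_split d N α ρl ρr Odd j hjN.le]
  have cEE := segProd_commute d N α ρl ρr Even Even j (N - j)
    (by intro i k hi h1 h2; rw [Nat.even_iff] at h1 h2; omega)
  have cOO := segProd_commute d N α ρl ρr Odd Odd j (N - j)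
    (by intro i k hi h1 h2; rw [Nat.odd_iff] at h1 h2; omega)
  constructor
  · intro he
    have cEO := segProd_commute d N α ρl ρr Even Odd j (N - j)
      (by intro i k hi h1 h2; rw [Nat.even_iff] at h1 he; rw [Nat.odd_iff] at h2; omega)
    rw [embedAt_seg d N α ρl ρr Even Even j (N - j) hm
        (by intro k; rw [Nat.even_iff] at *; rw [Nat.even_iff]; omega),
      embedAt_seg d N α ρl ρr Odd Odd j (N - j) hm
        (by intro k; rw [Nat.even_iff] at he; rw [Nat.odd_iff, Nat.odd_iff]; omega)]
    generalize segProd d N α ρl ρr Even 0 j = Ll at *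
    generalize segProd d N α ρl ρr Odd 0 j = Ml at *
    generalize segProd d N α ρl ρr Even j (N - j) = Lh at *
    generalize segProd d N α ρl ρr Odd j (N - j) = Mh at *
    constructor
    · rw [cEE.eq, cOO.eq, mul_assoc, ← mul_assoc Ll, cEO.eq]
      simp only [mul_assoc]
    · rw [mul_assoc, ← mul_assoc Mh, ← cEO.eq]
      simp only [mul_assoc]
  · intro ho
    have cOE := segProd_commute d N α ρl ρr Odd Even j (N - j)
      (by intro i k hi h1 h2; rw [Nat.odd_iff] at h1 ho; rw [Nat.even_iff] at h2; omega)
    rw [embedAt_seg d N α ρl ρr Even Odd j (N - j) hm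
        (by intro k; rw [Nat.odd_iff] at ho; rw [Nat.even_iff, Nat.odd_iff]; omega),
      embedAt_seg d N α ρl ρr Odd Even j (N - j) hm
        (by intro k; rw [Nat.odd_iff] at ho; rw [Nat.even_iff, Nat.odd_iff]; omega)]
    generalize segProd d N α ρl ρr Even 0 j = Ll at *
    generalize segProd d N α ρl ρr Odd 0 j = Ml at *
    generalize segProd d N α ρl ρr Even j (N - j) = Lh at *
    generalize segProd d N α ρl ρr Odd j (N - j) = Mh at *
    constructor
    · rw [mul_assoc, ← mul_assoc Lh, ← cOE.eq]
      simp only [mul_assoc]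
    · rw [cEE.eq, cOO.eq, mul_assoc, ← mul_assoc Ml, cOE.eq]
      simp only [mul_assoc]
end
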